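/- Weak Green's-function property of the Stokeslet: for every smooth compactly supported vector field φ : ℝ^d → ℝ^d satisfying the incompressibility constraint ∑_{j=1}^d ∂_j φ_j(x) = 0 for all x, and for every i ∈ {1,…,d}, the function x ↦ ∑_{j,k=1}^d ∂_k φ_j(x) ∂_k 𝒢_{ij}(x) is Lebesgue integrable on ℝ^d and ∫_{ℝ^d} ∑_{j,k=1}^d ∂_k φ_j(x) ∂_k 𝒢_{ij}(x) dx = φ_i(0). -/

import Mathlib

open MeasureTheory

/-- Surface area `ω_{d−1}` of the unit sphere in `ℝ^d`, i.e. `d` times the Lebesgue volume of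
the unit ball. -/
noncomputable def sphereArea (d : ℕ) : ℝ :=
  d * (volume (Metric.ball (0 : EuclideanSpace ℝ (Fin d)) 1)).toReal

/-- The Stokeslet `𝒢 : ℝ^d ∖ {0} → ℝ^{d×d}`, i.e. the Green's function of the steady Stokes
equations: `𝒢_{ij}(x) = (2(d−2)ω_{d−1})⁻¹ ‖x‖^{2−d} (δ_{ij} + (d−2) xᵢ xⱼ ‖x‖⁻²)`. -/
noncomputable def stokeslet (d : ℕ) (x : EuclideanSpace ℝ (Fin d)) : Fin d → Fin d → ℝ :=
  fun i j => (2 * ((d : ℝ) - 2) * sphereArea d)⁻¹ * ‖x‖ ^ ((2 : ℝ) - d) *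
    ((if i = j then (1 : ℝ) else 0) + ((d : ℝ) - 2) * x i * x j / ‖x‖ ^ 2)

section Homogeneous

open Set Filter Topology Metric Module

variable {E F : Type*} [NormedAddCommGroup E] [InnerProductSpace ℝ E]
  [NormedAddCommGroup F] [NormedSpace ℝ F]

/-- `f` is positively homogeneous of degree `a`. -/
def PosHomogeneous (a : ℝ) (f : E → F) : Prop :=
  ∀ t : ℝ, 0 < t → ∀ x, f (t • x) = t ^ a • f x

lemma PosHomogeneous.fderiv {a : ℝ} {f : E → F} (hf : PosHomogeneous a f) :
    PosHomogeneous (a - 1) (fderiv ℝ f) := by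
  intro t ht x
  have h : (fun y => f (t • y)) = fun y => t ^ a • f y := funext (hf t ht)
  have h1 := fderiv_comp_smul (𝕜 := ℝ) (f := f) (x := x) t
  rw [h, show (fun y => t ^ a • f y) = t ^ a • f from rfl, fderiv_const_smul_field,
    Pi.smul_apply] at h1
  rw [Real.rpow_sub_one ht.ne', div_eq_inv_mul, mul_smul, h1, smul_smul,
    inv_mul_cancel₀ ht.ne', one_smul]

lemma PosHomogeneous.norm_le [FiniteDimensional ℝ E] {a : ℝ} {f : E → F}
    (hf : PosHomogeneous a f) (hc : ContinuousOn f {0}ᶜ) :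
    ∃ C : ℝ, ∀ x ≠ 0, ‖f x‖ ≤ C * ‖x‖ ^ a := by
  obtain ⟨C, hC⟩ := (isCompact_sphere (0 : E) 1).exists_bound_of_continuousOn
    (hc.mono fun x hx => by
      rintro rfl
      simp at hx)
  refine ⟨C, fun x hx => ?_⟩
  have hx' : 0 < ‖x‖ := norm_pos_iff.2 hx
  have h1 := hf ‖x‖ hx' (‖x‖⁻¹ • x)
  rw [smul_smul, mul_inv_cancel₀ hx'.ne', one_smul] at h1
  rw [h1, norm_smul, Real.norm_of_nonneg (by positivity), mul_comm]
  gcongr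
  exact hC _ (by simp [norm_smul, hx'.ne'])

variable [FiniteDimensional ℝ E] [MeasurableSpace E] [BorelSpace E]

omit [NormedSpace ℝ F] in
lemma aestronglyMeasurable_of_continuousOn_compl_zero [Nontrivial E] {μ : Measure E}
    [μ.IsAddHaarMeasure] {f : E → F} (hc : ContinuousOn f {0}ᶜ) : AEStronglyMeasurable f μ := by
  have h := hc.aestronglyMeasurable (μ := μ) (measurableSet_singleton (0 : E)).compl
  rwa [Measure.restrict_eq_self_of_ae_mem] at h
  simp [ae_iff]

lemma integrable_mul_of_norm_le_rpow [Nontrivial E] {μ : Measure E} [μ.IsAddHaarMeasure]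
    {a C : ℝ} (ha : -(finrank ℝ E : ℝ) < a)
    {f v : E → ℝ} (hC : ∀ x ≠ 0, ‖f x‖ ≤ C * ‖x‖ ^ a) (hc : ContinuousOn f {0}ᶜ)
    (hv : Continuous v) (hvc : HasCompactSupport v) : Integrable (fun x => v x * f x) μ := by
  refine LocallyIntegrable.integrable_smul_left_of_hasCompactSupport ?_ hv hvc
  refine locallyIntegrable_of_norm_le_rpow (α := -a) (C := C) finrank_pos (by linarith) ?_
    (aestronglyMeasurable_of_continuousOn_compl_zero hc)
  filter_upwards [show ∀ᵐ x ∂μ, x ≠ 0 by simp [ae_iff]] with x hx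
  simpa using hC x hx

omit [MeasurableSpace E] [BorelSpace E] in
/-- Smooth cutoffs removing the origin, whose derivatives are dominated by `‖x‖⁻¹`. -/
lemma exists_cutoff_seq : ∃ (η : ℕ → E → ℝ) (C : ℝ),
    (∀ n, ContDiff ℝ 1 (η n)) ∧ (∀ n, η n =ᶠ[𝓝 0] 0) ∧ (∀ n x, ‖η n x‖ ≤ 1) ∧
    (∀ x ≠ 0, ∀ᶠ n in atTop, η n =ᶠ[𝓝 x] 1) ∧
    ∀ n, ∀ x ≠ 0, ‖fderiv ℝ (η n) x‖ ≤ C * ‖x‖⁻¹ := by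
  let f : ContDiffBump (0 : E) := ⟨1, 2, one_pos, one_lt_two⟩
  have hf : ContDiff ℝ 1 f := f.contDiff
  have hcont : Continuous (fderiv ℝ f) := hf.continuous_fderiv one_ne_zero
  obtain ⟨C, hC⟩ := (f.hasCompactSupport.fderiv (𝕜 := ℝ)).exists_bound_of_continuous hcont
  have hC' : ∀ y, ‖fderiv ℝ f y‖ * ‖y‖ ≤ C * 2 := by
    intro y
    by_cases hy : ‖y‖ ≤ 2
    · gcongr
      · exact (norm_nonneg _).trans (hC y)
      · exact hC y
    · have : fderiv ℝ f y = 0 := by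
        by_contra h
        have h2 := support_fderiv_subset ℝ (f := f) h
        rw [f.tsupport_eq] at h2
        exact hy (by simpa [f] using h2)
      rw [this]
      have := (norm_nonneg _).trans (hC y)
      simpa using this
  refine ⟨fun n x => 1 - f ((n + 1 : ℝ) • x), C * 2, fun n => ?_, fun n => ?_, fun n x => ?_,
    fun x hx => ?_, fun n x hx => ?_⟩
  · fun_prop
  · have h1 : Tendsto (fun x : E => (n + 1 : ℝ) • x) (𝓝 0) (𝓝 0) := by
      simpa using (continuous_const_smul (n + 1 : ℝ)).tendsto (0 : E)
    filter_upwards [h1.eventually f.eventuallyEq_one] with x hx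
    simp [hx]
  · rw [Real.norm_eq_abs, abs_le]
    constructor <;> linarith [f.nonneg (x := (n + 1 : ℝ) • x), f.le_one (x := (n + 1 : ℝ) • x)]
  · have hx' : 0 < ‖x‖ := norm_pos_iff.2 hx
    obtain ⟨N, hN⟩ := exists_nat_gt (2 / ‖x‖)
    filter_upwards [eventually_ge_atTop N] with n hn
    have hcn : Continuous fun y : E => ‖(n + 1 : ℝ) • y‖ := by fun_prop
    have : ∀ᶠ y in 𝓝 x, 2 < ‖(n + 1 : ℝ) • y‖ := by
      refine hcn.continuousAt.eventually_const_lt ?_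
      simp only [norm_smul]
      rw [Real.norm_of_nonneg (by positivity)]
      rw [div_lt_iff₀ hx'] at hN
      have : (N : ℝ) ≤ n := by exact_mod_cast hn
      nlinarith
    filter_upwards [this] with y hy
    rw [f.zero_of_le_dist (by simpa [f] using hy.le)]
    simp
  · have hx' : 0 < ‖x‖ := norm_pos_iff.2 hx
    have hn : (0 : ℝ) < n + 1 := by positivity
    rw [fderiv_const_sub, fderiv_comp_smul, norm_neg, norm_smul, ← div_eq_mul_inv, le_div_iff₀ hx']
    refine le_trans (le_of_eq ?_) (hC' ((n + 1 : ℝ) • x))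
    rw [norm_smul]
    ring

/-- Integration by parts against a function with an integrable singularity at the origin. -/
lemma integral_mul_fderiv_eq_neg_of_singular [Nontrivial E] {μ : Measure E} [μ.IsAddHaarMeasure]
    {v g : E → ℝ} (e : E)
    (hv : ContDiff ℝ 1 v) (hg : ∀ x ≠ 0, DifferentiableAt ℝ g x)
    (h1 : Integrable (fun x => v x * fderiv ℝ g x e) μ)
    (h2 : Integrable (fun x => fderiv ℝ v x e * g x) μ)
    (h3 : Integrable (fun x => v x * (‖x‖⁻¹ * g x)) μ)
    (h4 : Integrable (fun x => v x * g x) μ)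
    (hgm : AEStronglyMeasurable g μ) :
    ∫ x, v x * fderiv ℝ g x e ∂μ = -∫ x, fderiv ℝ v x e * g x ∂μ := by
  obtain ⟨η, C, hη, hη0, hη1, hηlim, hηd⟩ := exists_cutoff_seq (E := E)
  have hne : ∀ᵐ x ∂μ, x ≠ 0 := by simp [ae_iff]
  have hd (n x) : fderiv ℝ (fun y => η n y * v y) x e
      = η n x * fderiv ℝ v x e + v x * fderiv ℝ (η n) x e := by
    rw [fderiv_fun_mul ((hη n).differentiable one_ne_zero x) (hv.differentiable one_ne_zero x)]
    simp
  have hmη (n) : AEStronglyMeasurable (η n) μ := (hη n).continuous.aestronglyMeasurable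
  have hmη' (n) : AEStronglyMeasurable (fun x => fderiv ℝ (η n) x e) μ :=
    (((hη n).continuous_fderiv one_ne_zero).clm_apply continuous_const).aestronglyMeasurable
  have hmv : AEStronglyMeasurable v μ := hv.continuous.aestronglyMeasurable
  have m1 (n) : AEStronglyMeasurable (fun x => (η n x * v x) * fderiv ℝ g x e) μ := by
    simp only [mul_assoc]
    exact (hmη n).mul h1.1
  have m2 (n) : AEStronglyMeasurable (fun x => fderiv ℝ (fun y => η n y * v y) x e * g x) μ := by
    simp only [hd, add_mul, mul_assoc]
    exact ((hmη n).mul h2.1).add (hmv.mul ((hmη' n).mul hgm))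
  have b1 (n) : ∀ᵐ x ∂μ, ‖(η n x * v x) * fderiv ℝ g x e‖ ≤ ‖v x * fderiv ℝ g x e‖ := by
    refine .of_forall fun x => ?_
    rw [mul_assoc, norm_mul]
    exact mul_le_of_le_one_left (norm_nonneg _) (hη1 n x)
  have b2 (n) : ∀ᵐ x ∂μ, ‖fderiv ℝ (fun y => η n y * v y) x e * g x‖
      ≤ ‖fderiv ℝ v x e * g x‖ + C * ‖e‖ * ‖v x * (‖x‖⁻¹ * g x)‖ := by
    filter_upwards [hne] with x hx
    rw [hd, add_mul, mul_assoc]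
    refine (norm_add_le _ _).trans (add_le_add ?_ ?_)
    · rw [norm_mul]
      exact mul_le_of_le_one_left (norm_nonneg _) (hη1 n x)
    · have : ‖fderiv ℝ (η n) x e‖ ≤ C * ‖x‖⁻¹ * ‖e‖ :=
        (ContinuousLinearMap.le_opNorm _ _).trans (by gcongr; exact hηd n x hx)
      simp only [norm_mul, norm_inv, norm_norm]
      calc _ ≤ ‖v x‖ * (C * ‖x‖⁻¹ * ‖e‖) * ‖g x‖ := by gcongr
        _ = _ := by ring
  have i2 : Integrable
      (fun x => ‖fderiv ℝ v x e * g x‖ + C * ‖e‖ * ‖v x * (‖x‖⁻¹ * g x)‖) μ :=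
    h2.norm.add (h3.norm.const_mul _)
  have hn (n) : ∫ x, (η n x * v x) * fderiv ℝ g x e ∂μ
      = -∫ x, fderiv ℝ (fun y => η n y * v y) x e * g x ∂μ := by
    refine integral_mul_fderiv_eq_neg_fderiv_mul_of_integrable (i2.mono' (m2 n) (b2 n))
      (h1.norm.mono' (m1 n) (b1 n)) ?_
      (fun x _ => ((hη n).mul hv).differentiable one_ne_zero x) fun x hx => hg x ?_
    · refine h4.norm.mono' (((hmη n).mul hmv).mul hgm) (.of_forall fun x => ?_)
      rw [mul_assoc, norm_mul]
      exact mul_le_of_le_one_left (norm_nonneg _) (hη1 n x)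
    · rintro rfl
      refine notMem_tsupport_iff_eventuallyEq.2 ?_ hx
      filter_upwards [hη0 n] with y hy
      simp [hy]
  refine tendsto_nhds_unique (tendsto_integral_of_dominated_convergence _ m1 h1.norm b1 ?_)
    ((tendsto_congr hn).2
      (tendsto_integral_of_dominated_convergence _ m2 i2 b2 ?_).neg)
  · filter_upwards [hne] with x hx
    refine tendsto_const_nhds.congr' ?_
    filter_upwards [hηlim x hx] with n hn
    simp [hn.eq_of_nhds]
  · filter_upwards [hne] with x hx
    refine tendsto_const_nhds.congr' ?_
    filter_upwards [hηlim x hx] with n hn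
    rw [hd, hn.fderiv_eq, hn.eq_of_nhds]
    simp [Pi.one_def]

lemma PosHomogeneous.integrable_mul [Nontrivial E] {μ : Measure E} [μ.IsAddHaarMeasure]
    {a : ℝ} (ha : -(finrank ℝ E : ℝ) < a) {f v : E → ℝ} (hf : PosHomogeneous a f)
    (hc : ContinuousOn f {0}ᶜ) (hv : Continuous v) (hvc : HasCompactSupport v) :
    Integrable (fun x => v x * f x) μ := by
  obtain ⟨C, hC⟩ := hf.norm_le hc
  exact integrable_mul_of_norm_le_rpow ha hC hc hv hvc

lemma PosHomogeneous.integrable_mul_fderiv [Nontrivial E] {μ : Measure E} [μ.IsAddHaarMeasure]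
    {a : ℝ} (ha : 1 - (finrank ℝ E : ℝ) < a) {f v : E → ℝ} (hf : PosHomogeneous a f)
    (hc : ContDiffOn ℝ 1 f {0}ᶜ) (hv : Continuous v) (hvc : HasCompactSupport v) (e : E) :
    Integrable (fun x => v x * _root_.fderiv ℝ f x e) μ := by
  refine PosHomogeneous.integrable_mul (a := a - 1) (by linarith) (fun t ht x => ?_) ?_ hv hvc
  · rw [hf.fderiv t ht x]
    simp
  · exact (hc.continuousOn_fderiv_of_isOpen isOpen_compl_singleton le_rfl).clm_apply
      continuousOn_const

/-- Integration by parts against a homogeneous function with an integrable gradient singularity. -/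
lemma PosHomogeneous.integral_mul_fderiv [Nontrivial E] {μ : Measure E} [μ.IsAddHaarMeasure]
    {a : ℝ} (ha : 1 - (finrank ℝ E : ℝ) < a) {f v : E → ℝ} (hf : PosHomogeneous a f)
    (hc : ContDiffOn ℝ 1 f {0}ᶜ) (hv : ContDiff ℝ 1 v) (hvc : HasCompactSupport v) (e : E) :
    ∫ x, v x * _root_.fderiv ℝ f x e ∂μ = -∫ x, _root_.fderiv ℝ v x e * f x ∂μ := by
  have hv' : Continuous fun x => _root_.fderiv ℝ v x e :=
    (hv.continuous_fderiv one_ne_zero).clm_apply continuous_const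
  refine integral_mul_fderiv_eq_neg_of_singular e hv
    (fun x hx => (hc.differentiableOn one_ne_zero).differentiableAt
      (isOpen_compl_singleton.mem_nhds hx))
    (hf.integrable_mul_fderiv ha hc hv.continuous hvc e)
    (hf.integrable_mul (by linarith) hc.continuousOn hv' (hvc.fderiv_apply ℝ e))
    (PosHomogeneous.integrable_mul (a := a - 1) (by linarith) (fun t ht x => ?_) ?_
      hv.continuous hvc)
    (hf.integrable_mul (by linarith) hc.continuousOn hv.continuous hvc)
    (aestronglyMeasurable_of_continuousOn_compl_zero hc.continuousOn)
  · rw [hf t ht x, norm_smul, Real.norm_of_nonneg ht.le, Real.rpow_sub_one ht.ne']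
    simp only [smul_eq_mul, mul_inv]
    ring
  · exact (continuous_norm.continuousOn.inv₀ fun x hx => norm_ne_zero_iff.2 hx).mul hc.continuousOn

/-- Integration in polar coordinates. -/
lemma integral_eq_integral_toSphere [Nontrivial E] (μ : Measure E) [μ.IsAddHaarMeasure]
    {f : E → ℝ} (hf : Integrable f μ) :
    ∫ x, f x ∂μ = ∫ θ : sphere (0 : E) 1, (∫ r in Ioi (0 : ℝ),
      r ^ (finrank ℝ E - 1) * f (r • (θ : E))) ∂μ.toSphere := by
  have hmp := μ.measurePreserving_homeomorphUnitSphereProd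
  have hemb := (homeomorphUnitSphereProd E).measurableEmbedding
  let g : sphere (0 : E) 1 × Ioi (0 : ℝ) → ℝ := fun p => f ((homeomorphUnitSphereProd E).symm p)
  have hg (x : ({0}ᶜ : Set E)) : g (homeomorphUnitSphereProd E x) = f x := by
    simp only [g, Homeomorph.symm_apply_apply]
  have hgi : Integrable g (μ.toSphere.prod (Measure.volumeIoiPow (finrank ℝ E - 1))) := by
    rw [← hmp.integrable_comp_emb hemb, show g ∘ homeomorphUnitSphereProd E = f ∘ (↑) from
      funext hg, ← integrableOn_iff_comap_subtypeVal (measurableSet_singleton _).compl]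
    exact hf.integrableOn
  calc ∫ x, f x ∂μ = ∫ x : ({0}ᶜ : Set E), f x ∂(μ.comap (↑)) := by
        rw [integral_subtype_comap (measurableSet_singleton _).compl f, restrict_compl_singleton]
    _ = ∫ p, g p ∂μ.toSphere.prod (Measure.volumeIoiPow (finrank ℝ E - 1)) := by
        rw [← hmp.integral_comp hemb g]
        simp only [hg]
    _ = _ := by
        rw [integral_prod _ hgi]
        congr 1 with θ
        simp only [Measure.volumeIoiPow, ENNReal.ofReal, g, homeomorphUnitSphereProd_symm_apply_coe]
        rw [integral_withDensity_eq_integral_smul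
            (measurable_subtype_coe.pow_const _).real_toNNReal,
          integral_subtype_comap measurableSet_Ioi fun r =>
            Real.toNNReal (r ^ (finrank ℝ E - 1)) • f (r • (θ : E))]
        refine setIntegral_congr_fun measurableSet_Ioi fun r hr => ?_
        simp only [NNReal.smul_def, smul_eq_mul]
        rw [Real.coe_toNNReal _ (pow_nonneg hr.out.le _)]

/-- The radial form of the weak Green's-function property of the Laplacian. -/
lemma integral_fderiv_self_mul_rpow [Nontrivial E] (μ : Measure E) [μ.IsAddHaarMeasure]
    {ψ : E → ℝ} (hψ : ContDiff ℝ 1 ψ) (hψc : HasCompactSupport ψ) :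
    ∫ x, fderiv ℝ ψ x x * ‖x‖ ^ (-(finrank ℝ E : ℝ)) ∂μ
      = -(finrank ℝ E * μ.real (ball 0 1)) * ψ 0 := by
  have hcont : Continuous (fderiv ℝ ψ) := hψ.continuous_fderiv one_ne_zero
  have hpow (a : ℝ) : ContinuousOn (fun x : E => ‖x‖ ^ a) {0}ᶜ := fun x hx =>
    (continuous_norm.continuousAt.rpow_const (.inl (norm_ne_zero_iff.2 hx))).continuousWithinAt
  have hint : Integrable (fun x => fderiv ℝ ψ x x * ‖x‖ ^ (-(finrank ℝ E : ℝ))) μ := by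
    have h := integrable_mul_of_norm_le_rpow (μ := μ) (a := 1 - finrank ℝ E) (C := 1)
      (f := fun x : E => ‖x‖ ^ (1 - finrank ℝ E : ℝ)) (by linarith)
      (fun x _ => by rw [Real.norm_of_nonneg (by positivity), one_mul]) (hpow _)
      hcont.norm (hψc.fderiv ℝ).norm
    refine h.mono' (aestronglyMeasurable_of_continuousOn_compl_zero
      ((hcont.clm_apply continuous_id).continuousOn.mul (hpow _))) ?_
    filter_upwards [show ∀ᵐ x ∂μ, x ≠ 0 by simp [ae_iff]] with x hx
    rw [norm_mul, sub_eq_add_neg, Real.rpow_add (norm_pos_iff.2 hx), Real.rpow_one, ← mul_assoc,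
      Real.norm_of_nonneg (by positivity : 0 ≤ ‖x‖ ^ (-(finrank ℝ E : ℝ)))]
    gcongr
    exact ContinuousLinearMap.le_opNorm _ _
  have hray (θ : sphere (0 : E) 1) : ∫ r in Ioi (0 : ℝ), r ^ (finrank ℝ E - 1) *
      (fderiv ℝ ψ (r • (θ : E)) (r • (θ : E)) * ‖r • (θ : E)‖ ^ (-(finrank ℝ E : ℝ)))
      = -ψ 0 := by
    have hθ : ‖(θ : E)‖ = 1 := by simp
    have hc : HasCompactSupport fun r : ℝ => ψ (r • (θ : E)) := by
      obtain ⟨R, hR⟩ := hψc.isCompact.isBounded.subset_closedBall (0 : E)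
      refine HasCompactSupport.of_support_subset_isCompact (isCompact_closedBall (0 : ℝ) R)
        fun r hr => ?_
      simpa [norm_smul] using hR (subset_tsupport _ hr)
    have hd (r : ℝ) : HasDerivAt (fun r : ℝ => ψ (r • (θ : E))) (fderiv ℝ ψ (r • (θ : E)) θ) r := by
      have h := (hψ.differentiable one_ne_zero (r • (θ : E))).hasFDerivAt.comp_hasDerivAt r
        ((hasDerivAt_id r).smul_const (θ : E))
      simpa [Function.comp_def] using h
    have h := hc.integral_Ioi_deriv_eq (by fun_prop) 0
    rw [zero_smul] at h
    rw [← h]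
    refine setIntegral_congr_fun measurableSet_Ioi fun r hr => ?_
    have hr' : 0 < r := hr
    simp only [(hd r).deriv]
    have h1 : r ^ (finrank ℝ E) = r ^ (finrank ℝ E - 1) * r := by
      rw [← pow_succ, Nat.sub_add_cancel finrank_pos]
    rw [norm_smul, hθ, mul_one, Real.norm_of_nonneg hr'.le, Real.rpow_neg hr'.le,
      Real.rpow_natCast, h1, map_smul, smul_eq_mul]
    field_simp
  rw [integral_eq_integral_toSphere μ hint]
  simp only [hray]
  simp

end Homogeneous

section Stokeslet

open Set Module

variable {E : Type*} [NormedAddCommGroup E] [InnerProductSpace ℝ E]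

lemma hasFDerivAt_norm_rpow_of_ne_zero {x : E} (hx : x ≠ 0) (p : ℝ) :
    HasFDerivAt (fun y : E => ‖y‖ ^ p) ((p * ‖x‖ ^ (p - 2)) • innerSL ℝ x) x := by
  have hx' : 0 < ‖x‖ := norm_pos_iff.2 hx
  have h := ((hasStrictFDerivAt_norm_sq x).hasFDerivAt).rpow_const (p := p / 2)
    (.inl (by positivity))
  have h2 (y : E) (q : ℝ) : (‖y‖ ^ 2) ^ (q / 2) = ‖y‖ ^ q := by
    rw [← Real.rpow_natCast, ← Real.rpow_mul (norm_nonneg _)]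
    congr 1
    push_cast
    ring
  simp only [h2] at h
  convert h using 1
  rw [show p / 2 - 1 = (p - 2) / 2 by ring, h2]
  ext y
  simp
  ring

lemma contDiffOn_norm_rpow (p : ℝ) {n : WithTop ℕ∞} :
    ContDiffOn ℝ n (fun y : E => ‖y‖ ^ p) {0}ᶜ := fun _ hx =>
  ((contDiffAt_norm ℝ hx).rpow_const_of_ne (norm_ne_zero_iff.2 hx)).contDiffWithinAt

lemma posHomogeneous_norm_rpow (p : ℝ) : PosHomogeneous p (fun y : E => ‖y‖ ^ p) :=
  fun t ht x => by
    simp only [norm_smul, Real.norm_of_nonneg ht.le, smul_eq_mul]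
    exact Real.mul_rpow ht.le (norm_nonneg _)

lemma fderiv_fderiv_apply_comm {f : E → ℝ} (hf : ContDiff ℝ 2 f) (u v x : E) :
    fderiv ℝ (fun y => fderiv ℝ f y u) x v = fderiv ℝ (fun y => fderiv ℝ f y v) x u := by
  have hd : DifferentiableAt ℝ (fderiv ℝ f) x :=
    (hf.fderiv_right (m := 1) le_rfl).differentiable one_ne_zero x
  have hs := (hf.contDiffAt (x := x)).isSymmSndFDerivAt (by simp)
  rw [fderiv_clm_apply hd (differentiableAt_const _), fderiv_clm_apply hd (differentiableAt_const _)]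
  simpa using hs v u

variable {d : ℕ}

lemma posHomogeneous_stokeslet (i j : Fin d) :
    PosHomogeneous (2 - d : ℝ) (fun x : EuclideanSpace ℝ (Fin d) => stokeslet d x i j) := by
  intro t ht x
  have h := posHomogeneous_norm_rpow (E := EuclideanSpace ℝ (Fin d)) (2 - d) t ht x
  simp only [norm_smul, Real.norm_of_nonneg ht.le, smul_eq_mul] at h
  simp only [stokeslet, norm_smul, Real.norm_of_nonneg ht.le, smul_eq_mul, PiLp.smul_apply]
  have h2 : ((d : ℝ) - 2) * (t * x i) * (t * x j) / (t * ‖x‖) ^ 2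
      = ((d : ℝ) - 2) * x i * x j / ‖x‖ ^ 2 := by
    rw [mul_pow, ← mul_div_mul_left (((d : ℝ) - 2) * x i * x j) _ (pow_ne_zero 2 ht.ne')]
    ring
  rw [h2, h]
  ring

lemma contDiffOn_stokeslet (i j : Fin d) :
    ContDiffOn ℝ 1 (fun x : EuclideanSpace ℝ (Fin d) => stokeslet d x i j) {0}ᶜ := by
  have hp (k : Fin d) : ContDiffOn ℝ 1 (fun x : EuclideanSpace ℝ (Fin d) => x k) {0}ᶜ := by
    fun_prop
  refine (contDiffOn_const.mul (contDiffOn_norm_rpow _)).mul (contDiffOn_const.add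
    (((contDiffOn_const.mul (hp i)).mul (hp j)).div (contDiff_norm_sq ℝ).contDiffOn fun x hx => ?_))
  exact pow_ne_zero 2 (norm_ne_zero_iff.2 hx)

lemma posHomogeneous_coord_mul_norm_rpow (i : Fin d) (p : ℝ) :
    PosHomogeneous (p + 1) (fun x : EuclideanSpace ℝ (Fin d) => x i * ‖x‖ ^ p) := by
  intro t ht x
  have h := posHomogeneous_norm_rpow (E := EuclideanSpace ℝ (Fin d)) p t ht x
  simp only [smul_eq_mul] at h
  simp only [h, PiLp.smul_apply, smul_eq_mul, Real.rpow_add_one ht.ne']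
  ring

lemma contDiffOn_coord_mul_norm_rpow (i : Fin d) (p : ℝ) :
    ContDiffOn ℝ 1 (fun x : EuclideanSpace ℝ (Fin d) => x i * ‖x‖ ^ p) {0}ᶜ := by
  have hp : ContDiffOn ℝ 1 (fun x : EuclideanSpace ℝ (Fin d) => x i) {0}ᶜ := by fun_prop
  exact hp.mul (contDiffOn_norm_rpow p)

/-- Up to a gradient, the Stokeslet is a multiple of the fundamental solution of the Laplacian. -/
lemma stokeslet_eq_sub_fderiv (i j : Fin d) {x : EuclideanSpace ℝ (Fin d)} (hx : x ≠ 0) :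
    stokeslet d x i j = (2 * ((d : ℝ) - 2) * sphereArea d)⁻¹ *
      ((if i = j then 2 * ‖x‖ ^ (2 - d : ℝ) else 0) -
        fderiv ℝ (fun y : EuclideanSpace ℝ (Fin d) => y i * ‖y‖ ^ (2 - d : ℝ)) x
          (EuclideanSpace.single j 1)) := by
  have hx' : 0 < ‖x‖ := norm_pos_iff.2 hx
  have hc : HasFDerivAt (fun y : EuclideanSpace ℝ (Fin d) => y i)
      (EuclideanSpace.proj (𝕜 := ℝ) i : EuclideanSpace ℝ (Fin d) →L[ℝ] ℝ) x :=
    (EuclideanSpace.proj (𝕜 := ℝ) i : EuclideanSpace ℝ (Fin d) →L[ℝ] ℝ).hasFDerivAt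
  rw [(hc.fun_mul (hasFDerivAt_norm_rpow_of_ne_zero hx _)).fderiv]
  have h2 : ‖x‖ ^ (2 - d - 2 : ℝ) = ‖x‖ ^ (2 - d : ℝ) / ‖x‖ ^ 2 := by
    rw [Real.rpow_sub hx' (2 - d : ℝ), Real.rpow_two]
  simp only [stokeslet, add_apply, smul_apply, smul_eq_mul, innerSL_apply_apply,
    EuclideanSpace.inner_single_right, h2, PiLp.proj_apply, PiLp.single_apply]
  split_ifs <;> simp <;> ring

lemma sum_fderiv_single_mul (L : EuclideanSpace ℝ (Fin d) →L[ℝ] ℝ)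
    (x : EuclideanSpace ℝ (Fin d)) :
    ∑ k, L (EuclideanSpace.single k 1) * x k = L x := by
  conv_rhs => rw [← (EuclideanSpace.basisFun (Fin d) ℝ).sum_repr x]
  simp [mul_comm]

end Stokeslet

/-- **Weak Green's-function property of the Stokeslet:** for every smooth compactly supported
divergence-free vector field `φ` and every `i`, the function
`x ↦ ∑_{j,k} ∂_k φ_j(x) ∂_k 𝒢_{ij}(x)` is Lebesgue integrable on `ℝ^d` with integral `φ_i(0)`. -/
theorem stokeslet_weak_green_property (d : ℕ) (hd : 3 ≤ d)
    (φ : EuclideanSpace ℝ (Fin d) → EuclideanSpace ℝ (Fin d))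
    (hφ : ContDiff ℝ (⊤ : ℕ∞) φ) (hφc : HasCompactSupport φ)
    (hdiv : ∀ x : EuclideanSpace ℝ (Fin d),
      ∑ j : Fin d, fderiv ℝ (fun y : EuclideanSpace ℝ (Fin d) => φ y j) x
        (EuclideanSpace.single j 1) = 0)
    (i : Fin d) :
    Integrable (fun x : EuclideanSpace ℝ (Fin d) =>
      ∑ j : Fin d, ∑ k : Fin d,
        fderiv ℝ (fun y : EuclideanSpace ℝ (Fin d) => φ y j) x (EuclideanSpace.single k 1) *
        fderiv ℝ (fun y : EuclideanSpace ℝ (Fin d) => stokeslet d y i j) x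
          (EuclideanSpace.single k 1)) ∧
    ∫ x : EuclideanSpace ℝ (Fin d),
      (∑ j : Fin d, ∑ k : Fin d,
        fderiv ℝ (fun y : EuclideanSpace ℝ (Fin d) => φ y j) x (EuclideanSpace.single k 1) *
        fderiv ℝ (fun y : EuclideanSpace ℝ (Fin d) => stokeslet d y i j) x
          (EuclideanSpace.single k 1)) = φ 0 i := by
  have hd' : (3 : ℝ) ≤ d := by exact_mod_cast hd
  have : Nontrivial (EuclideanSpace ℝ (Fin d)) := by
    apply Module.nontrivial_of_finrank_pos (R := ℝ)
    rw [finrank_euclideanSpace_fin]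
    omega
  have hdim : (Module.finrank ℝ (EuclideanSpace ℝ (Fin d)) : ℝ) = d := by
    rw [finrank_euclideanSpace_fin]
  let e : Fin d → EuclideanSpace ℝ (Fin d) := fun k => EuclideanSpace.single k 1
  let ψ : Fin d → EuclideanSpace ℝ (Fin d) → ℝ := fun j y => φ y j
  have hψ (j) : ContDiff ℝ (⊤ : ℕ∞) (ψ j) := by fun_prop
  have hψc (j) : HasCompactSupport (ψ j) :=
    hφc.comp_left (g := fun y : EuclideanSpace ℝ (Fin d) => y j) rfl
  have hD {f : EuclideanSpace ℝ (Fin d) → ℝ} (hf : ContDiff ℝ (⊤ : ℕ∞) f) (k) :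
      ContDiff ℝ (⊤ : ℕ∞) fun x => fderiv ℝ f x (e k) :=
    (hf.fderiv_right (m := (⊤ : ℕ∞)) (by simp)).clm_apply contDiff_const
  have hle {f : EuclideanSpace ℝ (Fin d) → ℝ} (hf : ContDiff ℝ (⊤ : ℕ∞) f) {n : ℕ} :
      ContDiff ℝ n f := hf.of_le (by exact_mod_cast le_top)
  have hv (j k) : ContDiff ℝ (⊤ : ℕ∞) fun x => fderiv ℝ (ψ j) x (e k) := hD (hψ j) k
  have hvc (j k) : HasCompactSupport fun x => fderiv ℝ (ψ j) x (e k) :=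
    (hψc j).fderiv_apply ℝ (e k)
  have hw (j k) : ContDiff ℝ (⊤ : ℕ∞)
      fun x => fderiv ℝ (fun y => fderiv ℝ (ψ j) y (e k)) x (e k) := hD (hv j k) k
  have hwc (j k) : HasCompactSupport
      fun x => fderiv ℝ (fun y => fderiv ℝ (ψ j) y (e k)) x (e k) :=
    (hvc j k).fderiv_apply ℝ (e k)
  have hGi (j k) : Integrable fun x => fderiv ℝ (ψ j) x (e k) *
      fderiv ℝ (fun y => stokeslet d y i j) x (e k) :=
    (posHomogeneous_stokeslet i j).integrable_mul_fderiv (by rw [hdim]; linarith)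
      (contDiffOn_stokeslet i j) (hv j k).continuous (hvc j k) (e k)
  refine ⟨integrable_finsetSum _ fun j _ => integrable_finsetSum _ fun k _ => hGi j k, ?_⟩
  set c : ℝ := (2 * ((d : ℝ) - 2) * sphereArea d)⁻¹ with hcdef
  let N : EuclideanSpace ℝ (Fin d) → ℝ := fun y => ‖y‖ ^ (2 - d : ℝ)
  let h : EuclideanSpace ℝ (Fin d) → ℝ := fun y => y i * ‖y‖ ^ (2 - d : ℝ)
  have hN : PosHomogeneous (2 - d : ℝ) N := posHomogeneous_norm_rpow _
  have hNs : ContDiffOn ℝ 1 N {0}ᶜ := contDiffOn_norm_rpow _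
  have hh : PosHomogeneous (2 - d + 1 : ℝ) h := posHomogeneous_coord_mul_norm_rpow i _
  have hhs : ContDiffOn ℝ 1 h {0}ᶜ := contDiffOn_coord_mul_norm_rpow i _
  have hne : ∀ᵐ x : EuclideanSpace ℝ (Fin d), x ≠ 0 := by simp [ae_iff]
  have hw3 (j k) : Integrable fun x =>
      fderiv ℝ (fun z => fderiv ℝ (fun y => fderiv ℝ (ψ j) y (e k)) z (e k)) x (e j) * h x :=
    hh.integrable_mul (by rw [hdim]; linarith) hhs.continuousOn (hD (hw j k) j).continuous
      ((hwc j k).fderiv_apply ℝ (e j))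
  have hvN (k) : Integrable fun x => fderiv ℝ (ψ i) x (e k) * fderiv ℝ N x (e k) :=
    hN.integrable_mul_fderiv (by rw [hdim]; linarith) hNs (hv i k).continuous (hvc i k) (e k)
  have hterm (j k) : ∫ x, fderiv ℝ (ψ j) x (e k) * fderiv ℝ (fun y => stokeslet d y i j) x (e k)
      = c * ((if i = j then 2 * ∫ x, fderiv ℝ (ψ i) x (e k) * fderiv ℝ N x (e k) else 0) -
        ∫ x, fderiv ℝ (fun z => fderiv ℝ (fun y => fderiv ℝ (ψ j) y (e k)) z (e k)) x (e j)
          * h x) := by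
    have hwN : Integrable fun x => fderiv ℝ (fun y => fderiv ℝ (ψ j) y (e k)) x (e k) *
        (if i = j then 2 * N x else 0) := by
      split_ifs
      · simp only [mul_left_comm]
        exact (hN.integrable_mul (by rw [hdim]; linarith) hNs.continuousOn (hw j k).continuous
          (hwc j k)).const_mul 2
      · simp
    have hwh := hh.integrable_mul_fderiv (μ := volume) (by rw [hdim]; linarith) hhs
      (hw j k).continuous (hwc j k) (e j)
    have hae : ∀ᵐ x, fderiv ℝ (fun y => fderiv ℝ (ψ j) y (e k)) x (e k) * stokeslet d x i j
        = c * (fderiv ℝ (fun y => fderiv ℝ (ψ j) y (e k)) x (e k) * (if i = j then 2 * N x else 0)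
          - fderiv ℝ (fun y => fderiv ℝ (ψ j) y (e k)) x (e k) * fderiv ℝ h x (e j)) := by
      filter_upwards [hne] with x hx
      rw [stokeslet_eq_sub_fderiv i j hx]
      ring
    rw [(posHomogeneous_stokeslet i j).integral_mul_fderiv (by rw [hdim]; linarith)
      (contDiffOn_stokeslet i j) (hle (hv j k)) (hvc j k), integral_congr_ae hae,
      integral_const_mul, integral_sub hwN hwh,
      hh.integral_mul_fderiv (by rw [hdim]; linarith) hhs (hle (hw j k)) (hwc j k)]
    split_ifs with hij
    · subst hij
      rw [hN.integral_mul_fderiv (by rw [hdim]; linarith) hNs (hle (hv i k)) (hvc i k)]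
      simp only [mul_left_comm _ (2 : ℝ), integral_const_mul]
      ring
    · simp
  have hthird (k) (x : EuclideanSpace ℝ (Fin d)) : ∑ j,
      fderiv ℝ (fun z => fderiv ℝ (fun y => fderiv ℝ (ψ j) y (e k)) z (e k)) x (e j) = 0 := by
    have h1 (j) : fderiv ℝ (fun z => fderiv ℝ (fun y => fderiv ℝ (ψ j) y (e k)) z (e k)) x (e j)
        = fderiv ℝ (fun z => fderiv ℝ (fun y => fderiv ℝ (ψ j) y (e j)) z (e k)) x (e k) := by
      rw [fderiv_fderiv_apply_comm (hle (hv j k))]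
      simp only [fun z => fderiv_fderiv_apply_comm (hle (hψ j)) (e k) (e j) z]
    have h2 (z) : ∑ j, fderiv ℝ (fun y => fderiv ℝ (ψ j) y (e j)) z (e k) = 0 := by
      have h3 := fderiv_fun_sum (𝕜 := ℝ) (u := Finset.univ) (x := z)
        (A := fun j y => fderiv ℝ (ψ j) y (e j))
        fun j _ => (hle (n := 1) (hv j j)).differentiable one_ne_zero z
      rw [← _root_.sum_apply, ← h3]
      simp only [ψ, e, hdiv]
      simp
    have h3 := fderiv_fun_sum (𝕜 := ℝ) (u := Finset.univ) (x := x)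
      (A := fun j z => fderiv ℝ (fun y => fderiv ℝ (ψ j) y (e j)) z (e k))
      fun j _ => (hle (n := 1) (hD (hv j j) k)).differentiable one_ne_zero x
    simp only [h1]
    rw [← _root_.sum_apply, ← h3]
    simp only [h2]
    simp
  have hzero : ∑ j, ∑ k, ∫ x,
      fderiv ℝ (fun z => fderiv ℝ (fun y => fderiv ℝ (ψ j) y (e k)) z (e k)) x (e j) * h x = 0 := by
    rw [Finset.sum_comm]
    refine Finset.sum_eq_zero fun k _ => ?_
    rw [← integral_finsetSum _ fun j _ => hw3 j k]
    simp only [← Finset.sum_mul, hthird]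
    simp
  have hlap : ∑ k, ∫ x, fderiv ℝ (ψ i) x (e k) * fderiv ℝ N x (e k)
      = (d - 2) * sphereArea d * φ 0 i := by
    rw [← integral_finsetSum _ fun k _ => hvN k]
    have hae : ∀ᵐ x, ∑ k, fderiv ℝ (ψ i) x (e k) * fderiv ℝ N x (e k)
        = (2 - d) * (fderiv ℝ (ψ i) x x * ‖x‖ ^ (-(d : ℝ))) := by
      filter_upwards [hne] with x hx
      rw [(hasFDerivAt_norm_rpow_of_ne_zero hx _).fderiv, ← sum_fderiv_single_mul _ x,
        Finset.sum_mul, Finset.mul_sum]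
      refine Finset.sum_congr rfl fun k _ => ?_
      rw [show (2 - d - 2 : ℝ) = -d by ring]
      simp [e, EuclideanSpace.inner_single_right]
      ring
    have hpol := integral_fderiv_self_mul_rpow volume (hle (n := 1) (hψ i)) (hψc i)
    rw [hdim] at hpol
    rw [integral_congr_ae hae, integral_const_mul, hpol, sphereArea, measureReal_def]
    ring
  have hω : sphereArea d ≠ 0 := by
    have : 0 < (volume (Metric.ball (0 : EuclideanSpace ℝ (Fin d)) 1)).toReal :=
      ENNReal.toReal_pos (Metric.measure_ball_pos _ _ one_pos).ne' measure_ball_lt_top.ne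
    unfold sphereArea
    positivity
  rw [integral_finsetSum _ fun j _ => integrable_finsetSum _ fun k _ => hGi j k]
  simp only [fun j => integral_finsetSum Finset.univ fun k _ => hGi j k]
  simp only [hterm, ← Finset.mul_sum, Finset.sum_sub_distrib, hzero]
  rw [Finset.sum_comm]
  simp only [Finset.sum_ite_eq, Finset.mem_univ, if_true, ← Finset.mul_sum, hlap]
  have hd2 : (d : ℝ) - 2 ≠ 0 := by linarith
  rw [hcdef]
  field_simp
  ring
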